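/- Let $j, k$ be integers with $j, k \ge 3$ and $2/j + 2/k < 1/3$ (so that the triple $[3,j,k]$ has angle-sum $> 2$), let $i \in \{4, 5\}$, and let $l \ge 4$ be an integer. Let $x_1 > 1$ satisfy $2\arcsin(\cos(\pi/3)/x_1) + 2\arcsin(\cos(\pi/j)/x_1) + 2\arcsin(\cos(\pi/k)/x_1) = 2\pi$, and let $x_2 > 1$ satisfy $2\arcsin(\cos(\pi/3)/x_2) + 2\arcsin(\cos(\pi/i)/x_2) + 2\arcsin(\cos(\pi/j)/x_2) + 2\arcsin(\cos(\pi/l)/x_2) = 2\pi$. Then $x_1 < x_2$; in particular $\ell_{[3,j,k]} \ne \ell_{[3,i,j,l]}$. -/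

import Mathlib

open Real

/-- A right-angled bound: half of `arcsin y` is at most the arcsine of `y cos (π / 4)`. -/
theorem arcsin_le_two_mul_arcsin_cos_pi_div_four {y : ℝ} (h0 : 0 ≤ y) (h1 : y ≤ 1) :
    arcsin y ≤ 2 * arcsin (cos (π / 4) * y) := by
  have hpi := pi_pos
  have ht0 : 0 ≤ arcsin y := arcsin_nonneg.2 h0
  have ht1 : arcsin y ≤ π / 2 := arcsin_le_pi_div_two y
  have hs : 0 ≤ sin (arcsin y / 2) := sin_nonneg_of_nonneg_of_le_pi (by linarith) (by linarith)
  have hc : cos (π / 4) ≤ cos (arcsin y / 2) :=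
    cos_le_cos_of_nonneg_of_le_pi (by linarith) (by linarith) (by linarith)
  have hy : y = 2 * sin (arcsin y / 2) * cos (arcsin y / 2) := by
    rw [← sin_two_mul, mul_div_cancel₀ _ two_ne_zero, sin_arcsin (by linarith) h1]
  have hsq : cos (π / 4) * cos (π / 4) = 1 / 2 := by
    rw [cos_pi_div_four]
    nlinarith [Real.mul_self_sqrt (zero_le_two (α := ℝ))]
  have hpos : 0 ≤ cos (π / 4) := cos_nonneg_of_mem_Icc ⟨by linarith, by linarith⟩
  have hle : sin (arcsin y / 2) ≤ cos (π / 4) * y := by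
    calc sin (arcsin y / 2) = 2 * sin (arcsin y / 2) * (cos (π / 4) * cos (π / 4)) := by
          rw [hsq]; ring
      _ ≤ 2 * sin (arcsin y / 2) * (cos (π / 4) * cos (arcsin y / 2)) := by gcongr
      _ = cos (π / 4) * (2 * sin (arcsin y / 2) * cos (arcsin y / 2)) := by ring
      _ = cos (π / 4) * y := by rw [← hy]
  have := monotone_arcsin hle
  rw [arcsin_sin (by linarith) (by linarith)] at this
  linarith

theorem cos_pi_div_monotone {a b : ℝ} (ha : 1 ≤ a) (hab : a ≤ b) :
    cos (π / a) ≤ cos (π / b) := by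
  have ha0 : 0 < a := by linarith
  have hb0 : 0 < b := by linarith
  have hpi := pi_pos
  exact cos_le_cos_of_nonneg_of_le_pi (by positivity) (div_le_self hpi.le ha) (by gcongr)

theorem arcsin_div_antitone {c x y : ℝ} (hc : 0 ≤ c) (hx : 0 < x) (hxy : x ≤ y) :
    arcsin (c / y) ≤ arcsin (c / x) :=
  monotone_arcsin (by gcongr)

theorem cos_pi_div_nonneg {a : ℝ} (ha : 2 ≤ a) : 0 ≤ cos (π / a) := by
  simpa using cos_pi_div_monotone one_le_two ha

theorem cos_pi_div_lt_one {a : ℝ} (ha : 1 ≤ a) : cos (π / a) < 1 := by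
  have hpi := pi_pos
  have ha0 : 0 < a := by linarith
  simpa using cos_lt_cos_of_nonneg_of_le_pi le_rfl (div_le_self hpi.le ha) (by positivity)

/-- The side-length parameter of a fan of type `[3, j, k]` (with angle-sum `> 2`)
is strictly smaller than that of a fan of type `[3, i, j, l]` with `i ∈ {4, 5}`
and `l ≥ 4`; in particular `ℓ_{[3,j,k]} ≠ ℓ_{[3,i,j,l]}`. -/
theorem stmt_3 (j k i l : ℤ) (hj : 3 ≤ j) (hk : 3 ≤ k)
    (hangle : 2 / (j : ℝ) + 2 / (k : ℝ) < 1 / 3)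
    (hi : i = 4 ∨ i = 5) (hl : 4 ≤ l)
    (x₁ x₂ : ℝ) (hx₁ : 1 < x₁) (hx₂ : 1 < x₂)
    (heq₁ : 2 * arcsin (cos (π / 3) / x₁) + 2 * arcsin (cos (π / (j : ℝ)) / x₁)
        + 2 * arcsin (cos (π / (k : ℝ)) / x₁) = 2 * π)
    (heq₂ : 2 * arcsin (cos (π / 3) / x₂) + 2 * arcsin (cos (π / (i : ℝ)) / x₂)
        + 2 * arcsin (cos (π / (j : ℝ)) / x₂) + 2 * arcsin (cos (π / (l : ℝ)) / x₂)
        = 2 * π) :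
    x₁ < x₂ := by
  have hj' : (3 : ℝ) ≤ j := by exact_mod_cast hj
  have hk' : (3 : ℝ) ≤ k := by exact_mod_cast hk
  have hl' : (4 : ℝ) ≤ l := by exact_mod_cast hl
  have hi' : (4 : ℝ) ≤ i := by
    rcases hi with rfl | rfl <;> norm_num
  by_contra! hle
  have hx0 : 0 < x₂ := by linarith
  have hx0' : 0 < x₁ := by linarith
  have h3 := arcsin_div_antitone (cos_pi_div_nonneg (a := 3) (by norm_num)) hx0 hle
  have hj₁ := arcsin_div_antitone (cos_pi_div_nonneg (a := j) (by linarith)) hx0 hle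
  have large : ∀ a : ℝ, 4 ≤ a →
      arcsin (cos (π / 4) * (1 / x₁)) ≤ arcsin (cos (π / a) / x₂) := fun a ha =>
    calc arcsin (cos (π / 4) * (1 / x₁)) = arcsin (cos (π / 4) / x₁) := by rw [mul_one_div]
      _ ≤ arcsin (cos (π / 4) / x₂) :=
        arcsin_div_antitone (cos_pi_div_nonneg (by norm_num)) hx0 hle
      _ ≤ arcsin (cos (π / a) / x₂) := by
        have := cos_pi_div_monotone (by norm_num : (1 : ℝ) ≤ 4) ha
        exact monotone_arcsin (by gcongr)
  have hinv : 1 / x₁ ≤ 1 := by rw [div_le_one hx0']; exact hx₁.le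
  have hdouble := arcsin_le_two_mul_arcsin_cos_pi_div_four (by positivity) hinv
  have hk0 := cos_pi_div_nonneg (a := k) (by linarith)
  have hk1 := cos_pi_div_lt_one (a := k) (by linarith)
  have hklt : arcsin (cos (π / k) / x₁) < arcsin (1 / x₁) := by
    have h0 : 0 ≤ cos (π / k) / x₁ := by positivity
    exact arcsin_lt_arcsin (by linarith) (by gcongr) hinv
  linarith [large i hi', large l hl']
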